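/- arXiv:2010.14657 — 2 statements merged into one kernel-verified Lean document; each statement's English description precedes it below -/
import Mathlib

section
/- Let P be an n×n row-stochastic matrix with stationary distribution π, let D = diag(π), let Φ be an n×K real matrix, let γ ∈ (0,1), and let r(s,s') be real rewards. Define the mean TD(0) direction ḡ(θ) = Σ_{s,s'} π_s P(s,s') (r(s,s') + γ φ(s')ᵀθ − φ(s)ᵀθ) φ(s), and suppose θ* ∈ ℝ^K satisfies ḡ(θ*) = 0. Let B = Φᵀ D (I − γP) Φ. Then: (i) for every θ ∈ ℝ^K, ḡ(θ) = −B(θ − θ*); and (ii) for every u ∈ ℝ^K, uᵀ B u = (1−γ) ‖Φu‖_D² + γ ‖Φu‖_Dir². Consequently, −ḡ(θ) is a gradient splitting of the quadratic f(θ) = (1−γ) ‖V_θ − V_{θ*}‖_D² + γ ‖V_θ − V_{θ*}‖_Dir², where V_θ = Φθ. -/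
open scoped BigOperators
open Matrix

/-- The Dirichlet form of a chain with stationary weights `π` is `⟨v, (I - P) v⟩_D`. -/
theorem half_sum_sq_sub_eq_of_stationary {ι : Type*} [Fintype ι] {P : Matrix ι ι ℝ} {π : ι → ℝ}
    (hProw : ∀ i, ∑ j, P i j = 1) (hstat : ∀ j, ∑ i, π i * P i j = π j) (v : ι → ℝ) :
    (1 / 2) * ∑ s, ∑ s', π s * P s s' * (v s' - v s) ^ 2 =
      ∑ s, π s * v s ^ 2 - ∑ s, π s * v s * (P *ᵥ v) s := by
  have hsource : ∑ s, ∑ s', π s * P s s' * v s ^ 2 = ∑ s, π s * v s ^ 2 := by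
    refine Finset.sum_congr rfl fun s _ => ?_
    rw [← Finset.sum_mul, ← Finset.mul_sum, hProw, mul_one]
  have htarget : ∑ s, ∑ s', π s * P s s' * v s' ^ 2 = ∑ s, π s * v s ^ 2 := by
    rw [Finset.sum_comm]
    refine Finset.sum_congr rfl fun s _ => ?_
    rw [← Finset.sum_mul, hstat]
  have hcross : ∑ s, ∑ s', π s * P s s' * (v s * v s') = ∑ s, π s * v s * (P *ᵥ v) s := by
    refine Finset.sum_congr rfl fun s _ => ?_
    rw [Matrix.mulVec, dotProduct, Finset.mul_sum]
    exact Finset.sum_congr rfl fun s' _ => by ring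
  have hexpand : ∑ s, ∑ s', π s * P s s' * (v s' - v s) ^ 2 =
      ∑ s, ∑ s', π s * P s s' * v s' ^ 2 + ∑ s, ∑ s', π s * P s s' * v s ^ 2 -
        2 * ∑ s, ∑ s', π s * P s s' * (v s * v s') := by
    simp only [Finset.mul_sum, ← Finset.sum_add_distrib, ← Finset.sum_sub_distrib]
    exact Finset.sum_congr rfl fun s _ => Finset.sum_congr rfl fun s' _ => by ring
  rw [hexpand, hsource, htarget, hcross]
  ring

theorem transpose_mul_diagonal_mul_one_sub_smul_mul_mulVec {ι κ : Type*} [Fintype ι]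
    [DecidableEq ι] [Fintype κ] (P : Matrix ι ι ℝ) (π : ι → ℝ) (Φ : Matrix ι κ ℝ) (γ : ℝ)
    (u : κ → ℝ) :
    (Φ.transpose * Matrix.diagonal π * (1 - γ • P) * Φ) *ᵥ u =
      Φ.transpose *ᵥ fun s => π s * ((Φ *ᵥ u) s - γ * (P *ᵥ (Φ *ᵥ u)) s) := by
  simp only [← Matrix.mulVec_mulVec]
  congr 1
  ext s
  rw [Matrix.mulVec_diagonal, Matrix.sub_mulVec, Matrix.one_mulVec, Matrix.smul_mulVec,
    Pi.sub_apply, Pi.smul_apply, smul_eq_mul]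

/-- A quadratic form takes the same values on a real matrix and on its symmetric part. -/
theorem dotProduct_symmPart_mulVec {κ : Type*} [Fintype κ] (B : Matrix κ κ ℝ) (u : κ → ℝ) :
    u ⬝ᵥ ((1 / 2 : ℝ) • (B + B.transpose)) *ᵥ u = u ⬝ᵥ B *ᵥ u := by
  have h : u ⬝ᵥ B.transpose *ᵥ u = u ⬝ᵥ B *ᵥ u := by
    rw [Matrix.mulVec_transpose, dotProduct_comm, Matrix.dotProduct_mulVec]
  rw [Matrix.smul_mulVec, dotProduct_smul, Matrix.add_mulVec, dotProduct_add, h, smul_eq_mul]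
  ring

/-- The mean TD(0) direction `ḡ(θ)` satisfies `ḡ(θ) = −B(θ − θ*)` with
`B = Φᵀ D (I − γP) Φ`, and `uᵀ B u = (1−γ)‖Φu‖_D² + γ‖Φu‖_Dir²`; consequently
`−ḡ(θ)` is a gradient splitting of
`f(θ) = (1−γ)‖V_θ − V_{θ*}‖_D² + γ‖V_θ − V_{θ*}‖_Dir²`, `V_θ = Φθ`. -/
theorem stmt_2 (n K : ℕ) (hn : 0 < n) (hK : 0 < K)
    (P : Matrix (Fin n) (Fin n) ℝ) (π : Fin n → ℝ)
    (hPnn : ∀ i j, 0 ≤ P i j) (hProw : ∀ i, ∑ j, P i j = 1)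
    (hπnn : ∀ i, 0 ≤ π i) (hπ1 : ∑ i, π i = 1)
    (hstat : ∀ j, ∑ i, π i * P i j = π j)
    (Φ : Matrix (Fin n) (Fin K) ℝ) (γ : ℝ) (hγ : 0 < γ ∧ γ < 1)
    (r : Fin n → Fin n → ℝ)
    (gbar : (Fin K → ℝ) → (Fin K → ℝ))
    (hgbar : ∀ θ l, gbar θ l =
      ∑ s, ∑ s', π s * P s s' *
        (r s s' + γ * Φ.mulVec θ s' - Φ.mulVec θ s) * Φ s l)
    (θstar : Fin K → ℝ) (hθstar : gbar θstar = 0)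
    (B : Matrix (Fin K) (Fin K) ℝ)
    (hBdef : B = Φ.transpose * Matrix.diagonal π * (1 - γ • P) * Φ) :
    (∀ θ : Fin K → ℝ, gbar θ = -(B.mulVec (θ - θstar))) ∧
    (∀ u : Fin K → ℝ, u ⬝ᵥ B.mulVec u =
      (1 - γ) * (∑ s, π s * (Φ.mulVec u s)^2)
        + γ * ((1/2) * ∑ s, ∑ s', π s * P s s' * (Φ.mulVec u s' - Φ.mulVec u s)^2)) ∧
    (∃ A : Matrix (Fin K) (Fin K) ℝ, A.IsSymm ∧ A.PosSemidef ∧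
      B + B.transpose = (2 : ℝ) • A ∧
      ∀ θ : Fin K → ℝ, (θ - θstar) ⬝ᵥ A.mulVec (θ - θstar) =
        (1 - γ) * (∑ s, π s * (Φ.mulVec θ s - Φ.mulVec θstar s)^2)
          + γ * ((1/2) * ∑ s, ∑ s', π s * P s s' *
              ((Φ.mulVec θ s' - Φ.mulVec θstar s') - (Φ.mulVec θ s - Φ.mulVec θstar s))^2)) := by
  have hdirection : ∀ θ : Fin K → ℝ, gbar θ = -(B.mulVec (θ - θstar)) := by
    intro θ
    have hdiff : gbar θ = gbar θ - gbar θstar := by rw [hθstar, sub_zero]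
    rw [hdiff, hBdef, transpose_mul_diagonal_mul_one_sub_smul_mul_mulVec]
    ext l
    rw [Pi.sub_apply, hgbar, hgbar, Pi.neg_apply, Matrix.mulVec, dotProduct,
      ← Finset.sum_sub_distrib, ← Finset.sum_neg_distrib]
    refine Finset.sum_congr rfl fun s _ => ?_
    set w := Φ *ᵥ (θ - θstar) with hw
    have hwapply : ∀ t, (Φ *ᵥ θ) t = w t + (Φ *ᵥ θstar) t := fun t => by
      rw [hw, Matrix.mulVec_sub, Pi.sub_apply, sub_add_cancel]
    have hterm : ∀ s', π s * P s s' * (r s s' + γ * (Φ *ᵥ θ) s' - (Φ *ᵥ θ) s) * Φ s l -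
        π s * P s s' * (r s s' + γ * (Φ *ᵥ θstar) s' - (Φ *ᵥ θstar) s) * Φ s l =
        π s * Φ s l * γ * (P s s' * w s') - π s * Φ s l * w s * P s s' := fun s' => by
      rw [hwapply, hwapply]
      ring
    have hPw : ∑ s', P s s' * w s' = (P *ᵥ w) s := rfl
    rw [← Finset.sum_sub_distrib, Finset.sum_congr rfl fun s' _ => hterm s',
      Finset.sum_sub_distrib, ← Finset.mul_sum, ← Finset.mul_sum, hProw, hPw,
      Matrix.transpose_apply]
    ring
  have hquadratic : ∀ u : Fin K → ℝ, u ⬝ᵥ B.mulVec u =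
      (1 - γ) * (∑ s, π s * (Φ.mulVec u s)^2)
        + γ * ((1/2) * ∑ s, ∑ s', π s * P s s' * (Φ.mulVec u s' - Φ.mulVec u s)^2) := by
    intro u
    rw [half_sum_sq_sub_eq_of_stationary hProw hstat, hBdef,
      transpose_mul_diagonal_mul_one_sub_smul_mul_mulVec, Matrix.dotProduct_mulVec,
      Matrix.vecMul_transpose, dotProduct, mul_sub, Finset.mul_sum, Finset.mul_sum, Finset.mul_sum,
      ← Finset.sum_sub_distrib, ← Finset.sum_add_distrib]
    exact Finset.sum_congr rfl fun s _ => by ring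
  have hsymm : ((1 / 2 : ℝ) • (B + B.transpose)).IsSymm :=
    (Matrix.isSymm_add_transpose_self B).smul _
  refine ⟨hdirection, hquadratic, (1 / 2 : ℝ) • (B + B.transpose), hsymm, ?_, ?_, ?_⟩
  · refine Matrix.PosSemidef.of_dotProduct_mulVec_nonneg
      (by rw [Matrix.IsHermitian, Matrix.conjTranspose_eq_transpose_of_trivial]; exact hsymm)
      fun u => ?_
    rw [star_trivial, dotProduct_symmPart_mulVec, hquadratic]
    have hnorm : 0 ≤ ∑ s, π s * (Φ.mulVec u s)^2 :=
      Finset.sum_nonneg fun s _ => mul_nonneg (hπnn s) (sq_nonneg _)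
    have hdir : 0 ≤ ∑ s, ∑ s', π s * P s s' * (Φ.mulVec u s' - Φ.mulVec u s)^2 :=
      Finset.sum_nonneg fun s _ => Finset.sum_nonneg fun s' _ =>
        mul_nonneg (mul_nonneg (hπnn s) (hPnn s s')) (sq_nonneg _)
    exact add_nonneg (mul_nonneg (sub_nonneg.2 hγ.2.le) hnorm)
      (mul_nonneg hγ.1.le (mul_nonneg (by norm_num) hdir))
  · rw [smul_smul]
    norm_num
  · intro θ
    rw [dotProduct_symmPart_mulVec, hquadratic, Matrix.mulVec_sub]
    rfl
end

section
/- Let t₀ be a natural number, let (e_t)_{t ≥ t₀} be a sequence of nonnegative reals, and let (b_t)_{t ≥ t₀} be a nondecreasing sequence of nonnegative reals such that for all t > t₀, e_t ≤ (1 − 2/(t+1)) e_{t−1} + b_t/(t+1)². Define C_t = max{ (t₀+1) e_{t₀}, b_t }. Then for all t ≥ t₀, e_t ≤ C_t/(t+1). -/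
/-- Deterministic induction: if `e_t ≤ (1 − 2/(t+1)) e_{t−1} + b_t/(t+1)²` for `t > t₀`,
with `(e_t)` nonnegative and `(b_t)` nonnegative and nondecreasing, then with
`C_t = max{(t₀+1)e_{t₀}, b_t}` one has `e_t ≤ C_t/(t+1)` for all `t ≥ t₀`. -/
theorem stmt_14 (t₀ : ℕ) (e b : ℕ → ℝ)
    (he : ∀ t, t₀ ≤ t → 0 ≤ e t)
    (hbnn : ∀ t, t₀ ≤ t → 0 ≤ b t)
    (hbmono : ∀ s t, t₀ ≤ s → s ≤ t → b s ≤ b t)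
    (hrec : ∀ t, t₀ < t →
      e t ≤ (1 - 2 / ((t : ℝ) + 1)) * e (t - 1) + b t / ((t : ℝ) + 1) ^ 2)
    (C : ℕ → ℝ) (hC : ∀ t, C t = max (((t₀ : ℝ) + 1) * e t₀) (b t)) :
    ∀ t, t₀ ≤ t → e t ≤ C t / ((t : ℝ) + 1) := by
  intro t ht
  induction t, ht using Nat.le_induction with
  | base =>
    rw [le_div_iff₀ (by positivity), mul_comm, hC]
    exact le_max_left _ _
  | succ n hn ih =>
    have hr := hrec (n + 1) (Nat.lt_succ_of_le hn)
    rw [Nat.add_sub_cancel] at hr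
    push_cast at hr ⊢
    have hCn : C n ≤ C (n + 1) := by
      rw [hC, hC]
      exact max_le_max le_rfl (hbmono n (n + 1) hn n.le_succ)
    have hbC : b (n + 1) ≤ C (n + 1) := by
      rw [hC]
      exact le_max_right _ _
    have hC0 : 0 ≤ C (n + 1) := (hbnn _ (Nat.le_succ_of_le hn)).trans hbC
    have hcoef : (0 : ℝ) ≤ 1 - 2 / ((n : ℝ) + 1 + 1) := by
      rw [sub_nonneg, div_le_one (by positivity)]
      linarith [n.cast_nonneg (α := ℝ)]
    calc
      e (n + 1) ≤ (1 - 2 / ((n : ℝ) + 1 + 1)) * e n + b (n + 1) / ((n : ℝ) + 1 + 1) ^ 2 := hr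
      _ ≤ (1 - 2 / ((n : ℝ) + 1 + 1)) * (C (n + 1) / ((n : ℝ) + 1))
          + C (n + 1) / ((n : ℝ) + 1 + 1) ^ 2 := by
        gcongr
        exact ih.trans (by gcongr)
      _ = C (n + 1) / ((n : ℝ) + 1 + 1)
          - C (n + 1) / (((n : ℝ) + 1) * ((n : ℝ) + 1 + 1) ^ 2) := by
        field_simp
        ring
      _ ≤ C (n + 1) / ((n : ℝ) + 1 + 1) := sub_le_self _ (by positivity)
end
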